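/- Existence of an optimal stationary policy in a finite MDP: there exists a policy π_* such that v_{π_*} ≥ v_π componentwise for every stochastic policy π; moreover v_{π_*} = v_*, the unique fixed point of T_*. -/

import Mathlib

/-- Comparison principle: a subsolution lies below a supersolution. -/
theorem mdp_comparison {S A : Type*} [Fintype S]
    (P : S → A → S → ℝ) (hP0 : ∀ s a s', 0 ≤ P s a s')
    (hP1 : ∀ s a, ∑ s', P s a s' = 1)
    (R : S → A → ℝ) (γ : ℝ) (hγ0 : 0 < γ) (hγ1 : γ < 1) (v w : S → ℝ)
    (hv : ∀ s, ∃ a, v s ≤ R s a + γ * ∑ s', P s a s' * v s')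
    (hw : ∀ s a, R s a + γ * ∑ s', P s a s' * w s' ≤ w s) (s : S) : v s ≤ w s := by
  obtain ⟨s0, -, h0⟩ := Finset.exists_max_image Finset.univ (fun s => v s - w s) ⟨s, Finset.mem_univ s⟩
  obtain ⟨a, ha⟩ := hv s0
  have h1 : ∑ s', P s0 a s' * v s' ≤ ∑ s', P s0 a s' * w s' + (v s0 - w s0) := by
    calc ∑ s', P s0 a s' * v s' ≤ ∑ s', (P s0 a s' * w s' + P s0 a s' * (v s0 - w s0)) := by
          apply Finset.sum_le_sum
          intro s' _
          have := mul_le_mul_of_nonneg_left (h0 s' (Finset.mem_univ _)) (hP0 s0 a s')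
          linarith
      _ = _ := by rw [Finset.sum_add_distrib, ← Finset.sum_mul, hP1, one_mul]
  have h2 := mul_le_mul_of_nonneg_left h1 hγ0.le
  have h3 := hw s0 a
  have h4 := h0 s (Finset.mem_univ _)
  have : v s0 - w s0 ≤ 0 := by
    by_contra! hc
    nlinarith
  linarith

/-- The Bellman optimality operator has a fixed point. -/
theorem mdp_fixed_point {S A : Type*} [Fintype S] [Fintype A] [Nonempty A]
    (P : S → A → S → ℝ) (hP0 : ∀ s a s', 0 ≤ P s a s')
    (hP1 : ∀ s a, ∑ s', P s a s' = 1)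
    (R : S → A → ℝ) (γ : ℝ) (hγ0 : 0 < γ) (hγ1 : γ < 1) :
    ∃ v : S → ℝ, ∀ s, v s = Finset.univ.sup' Finset.univ_nonempty
          (fun a => R s a + γ * ∑ s', P s a s' * v s') := by
  let T : (S → ℝ) → (S → ℝ) := fun v s => Finset.univ.sup' Finset.univ_nonempty
          (fun a => R s a + γ * ∑ s', P s a s' * v s')
  have key : ∀ v w s, T v s ≤ T w s + γ * dist v w := by
    intro v w s
    apply Finset.sup'_le
    intro a _
    have h1 : ∑ s', P s a s' * v s' ≤ ∑ s', P s a s' * w s' + dist v w := by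
      calc ∑ s', P s a s' * v s' ≤ ∑ s', (P s a s' * w s' + P s a s' * dist v w) := by
            apply Finset.sum_le_sum
            intro s' _
            have h := (le_abs_self _).trans ((Real.dist_eq (v s') (w s')).symm.le.trans (dist_le_pi_dist v w s'))
            have := mul_le_mul_of_nonneg_left h (hP0 s a s')
            linarith
        _ = _ := by rw [Finset.sum_add_distrib, ← Finset.sum_mul, hP1, one_mul]
    have h2 := mul_le_mul_of_nonneg_left h1 hγ0.le
    have h3 : R s a + γ * ∑ s', P s a s' * w s' ≤ T w s :=
      Finset.le_sup' (fun a => R s a + γ * ∑ s', P s a s' * w s') (Finset.mem_univ a)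
    linarith
  have hT : ContractingWith ⟨γ, hγ0.le⟩ T := by
    refine ⟨by exact_mod_cast hγ1, LipschitzWith.of_dist_le_mul fun v w => ?_⟩
    change dist (T v) (T w) ≤ γ * dist v w
    rw [dist_pi_le_iff (by positivity)]
    intro s
    rw [Real.dist_eq, abs_le]
    have h1 := key v w s
    have h2 := key w v s
    rw [dist_comm w v] at h2
    constructor <;> linarith
  exact ⟨ContractingWith.fixedPoint T hT, fun s => (congrFun hT.fixedPoint_isFixedPt s).symm⟩

/-- existence of an optimal stationary (stochastic) policy in a
finite MDP: there is a policy π_* whose value dominates the value of every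
stochastic policy componentwise, and this value is the unique fixed point of T_*. -/
theorem exists_optimal_policy
    {S A : Type*} [Fintype S] [Fintype A] [Nonempty A]
    (P : S → A → S → ℝ) (hP0 : ∀ s a s', 0 ≤ P s a s')
    (hP1 : ∀ s a, ∑ s', P s a s' = 1)
    (R : S → A → ℝ) (γ : ℝ) (hγ0 : 0 < γ) (hγ1 : γ < 1) :
    ∃ (πstar : S → A → ℝ) (vstar : S → ℝ),
      (∀ s a, 0 ≤ πstar s a) ∧ (∀ s, ∑ a, πstar s a = 1)
      ∧ (∀ s, vstar s = (∑ a, πstar s a * R s a)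
          + γ * ∑ s', (∑ a, πstar s a * P s a s') * vstar s')
      ∧ (∀ (π : S → A → ℝ) (v : S → ℝ),
          (∀ s a, 0 ≤ π s a) → (∀ s, ∑ a, π s a = 1) →
          (∀ s, v s = (∑ a, π s a * R s a)
              + γ * ∑ s', (∑ a, π s a * P s a s') * v s') →
          ∀ s, v s ≤ vstar s)
      ∧ (∀ s, vstar s = Finset.univ.sup' Finset.univ_nonempty
          (fun a => R s a + γ * ∑ s', P s a s' * vstar s'))
      ∧ (∀ w : S → ℝ, (∀ s, w s = Finset.univ.sup' Finset.univ_nonempty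
          (fun a => R s a + γ * ∑ s', P s a s' * w s')) → w = vstar) := by
  classical
  obtain ⟨v, hv⟩ := mdp_fixed_point P hP0 hP1 R γ hγ0 hγ1
  have sub : ∀ w : S → ℝ, (∀ s, w s = Finset.univ.sup' Finset.univ_nonempty
          (fun a => R s a + γ * ∑ s', P s a s' * w s')) →
      ∀ s, ∃ a, w s = R s a + γ * ∑ s', P s a s' * w s' := by
    intro w hw s
    obtain ⟨a, -, ha⟩ := Finset.exists_mem_eq_sup' Finset.univ_nonempty
      (fun a => R s a + γ * ∑ s', P s a s' * w s')
    exact ⟨a, (hw s).trans ha⟩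
  have sup : ∀ w : S → ℝ, (∀ s, w s = Finset.univ.sup' Finset.univ_nonempty
          (fun a => R s a + γ * ∑ s', P s a s' * w s')) →
      ∀ s a, R s a + γ * ∑ s', P s a s' * w s' ≤ w s := by
    intro w hw s a
    rw [hw s]
    exact Finset.le_sup' (fun a => R s a + γ * ∑ s', P s a s' * w s') (Finset.mem_univ a)
  choose f hf using sub v hv
  refine ⟨fun s a => if a = f s then 1 else 0, v, ?_, ?_, ?_, ?_, hv, ?_⟩
  · intro s a
    dsimp only
    split_ifs <;> norm_num
  · intro s
    simp
  · intro s
    simpa using hf s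
  · intro π u h0 h1 hu
    refine mdp_comparison P hP0 hP1 R γ hγ0 hγ1 u v ?_ (sup v hv)
    intro s
    by_contra! hc
    have e : u s = ∑ a, π s a * (R s a + γ * ∑ s', P s a s' * u s') := by
      rw [hu s]
      simp only [mul_add, Finset.sum_add_distrib]
      congr 1
      simp only [Finset.sum_mul, Finset.mul_sum]
      rw [Finset.sum_comm]
      refine Finset.sum_congr rfl fun a _ => Finset.sum_congr rfl fun s' _ => by ring
    have e2 : u s = ∑ a, π s a * u s := by rw [← Finset.sum_mul, h1, one_mul]
    obtain ⟨a, ha⟩ : ∃ a, 0 < π s a := by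
      by_contra! hn
      have := Finset.sum_nonpos fun a (_ : a ∈ Finset.univ) => hn a
      rw [h1] at this
      linarith
    have : ∑ a, π s a * (R s a + γ * ∑ s', P s a s' * u s') < ∑ a, π s a * u s :=
      Finset.sum_lt_sum (fun a _ => mul_le_mul_of_nonneg_left (hc a).le (h0 s a))
        ⟨a, Finset.mem_univ a, mul_lt_mul_of_pos_left (hc a) ha⟩
    linarith
  · intro w hw
    funext s
    apply le_antisymm
    · exact mdp_comparison P hP0 hP1 R γ hγ0 hγ1 w v
        (fun s => (sub w hw s).imp fun a h => h.le) (sup v hv) s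
    · exact mdp_comparison P hP0 hP1 R γ hγ0 hγ1 v w
        (fun s => (sub v hv s).imp fun a h => h.le) (sup w hw) s
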